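/- arXiv:2011.07715 — 4 statements merged into one kernel-verified Lean document; each statement's English description precedes it below -/
import Mathlib

section
/- Let S̃ and S be finite types, let P̃ : Matrix S̃ S̃ ℝ and P : Matrix S S ℝ be row-stochastic matrices, and let Φ : Matrix S̃ S ℝ be row-stochastic (row Φ(s̃, ·) is the conditional distribution of the true state given the augmented state s̃). Assume the intertwining relation P̃ * Φ = Φ * P. Let r : S → ℝ, γ ∈ [0,1), and define the true value function V(s) = Σ_{k=0}^∞ γ^k (P^k.mulVec r)(s) and the augmented value function Ṽ(s̃) = Σ_{k=0}^∞ γ^k (P̃^k.mulVec (Φ.mulVec r))(s̃). Then Ṽ(s̃) = Σ_{s ∈ S} Φ(s̃, s) · V(s) for every s̃ ∈ S̃, i.e., Ṽ = Φ.mulVec V. -/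
theorem Matrix.abs_mulVec_le_norm_of_mem_rowStochastic {n : Type*} [Fintype n] [DecidableEq n]
    {M : Matrix n n ℝ} (hM : M ∈ Matrix.rowStochastic ℝ n) (r : n → ℝ) (i : n) :
    |M.mulVec r i| ≤ ‖r‖ := by
  calc |M.mulVec r i| ≤ ∑ j, |M i j * r j| := Finset.abs_sum_le_sum_abs _ _
    _ ≤ ∑ j, M i j * ‖r‖ := by
      gcongr with j
      rw [abs_mul, abs_of_nonneg (Matrix.nonneg_of_mem_rowStochastic hM)]
      exact mul_le_mul_of_nonneg_left (norm_le_pi_norm r j)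
        (Matrix.nonneg_of_mem_rowStochastic hM)
    _ = ‖r‖ := by
      rw [← Finset.sum_mul, Matrix.sum_row_of_mem_rowStochastic hM, one_mul]

theorem Matrix.summable_discounted_mulVec_of_mem_rowStochastic {n : Type*} [Fintype n]
    [DecidableEq n] {P : Matrix n n ℝ} (hP : P ∈ Matrix.rowStochastic ℝ n) (r : n → ℝ)
    {γ : ℝ} (hγ0 : 0 ≤ γ) (hγ1 : γ < 1) (i : n) :
    Summable fun k : ℕ => γ ^ k * ((P ^ k).mulVec r) i := by
  refine Summable.of_norm_bounded ((summable_geometric_of_lt_one hγ0 hγ1).mul_right ‖r‖)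
    fun k => ?_
  rw [Real.norm_eq_abs, abs_mul, abs_of_nonneg (pow_nonneg hγ0 k)]
  exact mul_le_mul_of_nonneg_left
    (Matrix.abs_mulVec_le_norm_of_mem_rowStochastic (pow_mem hP k) r i) (pow_nonneg hγ0 k)

theorem Matrix.pow_mul_eq_mul_pow_of_intertwine {m n R : Type*} [Fintype m] [DecidableEq m]
    [Fintype n] [DecidableEq n] [Semiring R] {A : Matrix m m R} {B : Matrix n n R}
    {C : Matrix m n R} (h : A * C = C * B) (k : ℕ) : A ^ k * C = C * B ^ k := by
  induction k with
  | zero => simp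
  | succ k ih => rw [pow_succ, Matrix.mul_assoc, h, ← Matrix.mul_assoc, ih, Matrix.mul_assoc,
      ← pow_succ]


theorem augmented_value_eq_expected_true_value
    {St S : Type*} [Fintype St] [DecidableEq St] [Nonempty St]
    [Fintype S] [DecidableEq S] [Nonempty S]
    (Pt : Matrix St St ℝ) (P : Matrix S S ℝ) (Φ : Matrix St S ℝ)
    (hPt0 : ∀ i j, 0 ≤ Pt i j) (hPt1 : ∀ i, ∑ j, Pt i j = 1)
    (hP0 : ∀ i j, 0 ≤ P i j) (hP1 : ∀ i, ∑ j, P i j = 1)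
    (hΦ0 : ∀ i j, 0 ≤ Φ i j) (hΦ1 : ∀ i, ∑ j, Φ i j = 1)
    (hint : Pt * Φ = Φ * P)
    (r : S → ℝ) (γ : ℝ) (hγ0 : 0 ≤ γ) (hγ1 : γ < 1)
    (V : S → ℝ) (hV : ∀ s, V s = ∑' k : ℕ, γ ^ k * ((P ^ k).mulVec r) s)
    (Vt : St → ℝ)
    (hVt : ∀ st, Vt st = ∑' k : ℕ, γ ^ k * ((Pt ^ k).mulVec (Φ.mulVec r)) st) :
    ∀ st : St, Vt st = ∑ s : S, Φ st s * V s := by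
  intro st
  have hP : P ∈ Matrix.rowStochastic ℝ S := Matrix.mem_rowStochastic_iff_sum.mpr ⟨hP0, hP1⟩
  have hs := Matrix.summable_discounted_mulVec_of_mem_rowStochastic hP r hγ0 hγ1
  simp_rw [hVt, hV, ← tsum_mul_left]
  rw [← Summable.tsum_finsetSum fun s _ => (hs s).mul_left (Φ st s)]
  refine tsum_congr fun k => ?_
  rw [Matrix.mulVec_mulVec, Matrix.pow_mul_eq_mul_pow_of_intertwine hint,
    ← Matrix.mulVec_mulVec, Matrix.mulVec, dotProduct, Finset.mul_sum]
  exact Finset.sum_congr rfl fun s _ => mul_left_comm _ _ _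
end

section
/- Let S be a finite type, A a nonempty finite type, w : S → ℝ a probability vector (w(s) ≥ 0 for all s and Σ_s w(s) = 1), and Q : S → A → ℝ with Q(s,a) ≥ 0 for all s, a. Define V(s) = max_{a ∈ A} Q(s,a), and let a* ∈ A be any maximizer of a ↦ Σ_{s ∈ S} w(s) · Q(s,a). Then Σ_{s ∈ S} w(s) · (Q(s,a*) − V(s)) ≥ (1/|A| − 1) · Σ_{s ∈ S} w(s) · V(s). -/
theorem expected_advantage_bound
    {S A : Type*} [Fintype S] [Fintype A] [Nonempty A]
    (w : S → ℝ) (hw0 : ∀ s, 0 ≤ w s) (hw1 : ∑ s, w s = 1)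
    (Q : S → A → ℝ) (hQ : ∀ s a, 0 ≤ Q s a)
    (V : S → ℝ)
    (hV : ∀ s, V s = Finset.univ.sup' Finset.univ_nonempty (fun a => Q s a))
    (astar : A)
    (hastar : ∀ a : A, ∑ s, w s * Q s a ≤ ∑ s, w s * Q s astar) :
    ∑ s, w s * (Q s astar - V s)
      ≥ (1 / (Fintype.card A : ℝ) - 1) * ∑ s, w s * V s := by
  have hVsum : ∀ s, V s ≤ ∑ a, Q s a := fun s => by
    rw [hV s]
    exact Finset.sup'_le _ _ fun a _ =>
      Finset.single_le_sum (fun b _ => hQ s b) (Finset.mem_univ a)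
  have hcard : (0 : ℝ) < Fintype.card A := by exact_mod_cast Fintype.card_pos
  have hmain : ∑ s, w s * V s ≤ (∑ s, w s * Q s astar) * Fintype.card A := calc
    ∑ s, w s * V s ≤ ∑ s, w s * ∑ a, Q s a :=
      Finset.sum_le_sum fun s _ => mul_le_mul_of_nonneg_left (hVsum s) (hw0 s)
    _ = ∑ a, ∑ s, w s * Q s a := by
      simp_rw [Finset.mul_sum]
      exact Finset.sum_comm
    _ ≤ ∑ _a : A, ∑ s, w s * Q s astar := Finset.sum_le_sum fun a _ => hastar a
    _ = (∑ s, w s * Q s astar) * Fintype.card A := by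
      rw [Finset.sum_const, Finset.card_univ, nsmul_eq_mul, mul_comm]
  have hdiv := (div_le_iff₀ hcard).2 hmain
  simp_rw [mul_sub, Finset.sum_sub_distrib]
  rw [sub_mul, one_div_mul_eq_div, one_mul]
  exact sub_le_sub_right hdiv _
end

section
/- In the delayed-MDP setup below, for every augmented state s̃ = (s, (a_1, …, a_d)) ∈ S̃, every action a ∈ A, and every s'' ∈ S: Σ_{s' ∈ S} P_{a_1}(s, s') · φ((s', (a_2, …, a_d, a)))(s'') = Σ_{σ ∈ S} φ(s̃)(σ) · P_a(σ, s''). That is, the expected next belief (averaging the belief of the successor augmented state over the resolution of the oldest pending action) equals the current belief pushed forward through the transition matrix of the newly played action a. -/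
/-- Dropping the first of `d` factors and appending `a` on the right gives the same word as
the original product times `a`, once the dropped factor is restored on the left. -/
theorem mul_prod_ofFn_shift {M A : Type*} [Monoid M] (P : A → M) {d : ℕ} (hd : 0 < d)
    (as : Fin d → A) (a : A) :
    P (as ⟨0, hd⟩) * (List.ofFn fun i : Fin d =>
        P (if h : (i : ℕ) + 1 < d then as ⟨(i : ℕ) + 1, h⟩ else a)).prod
      = (List.ofFn fun i => P (as i)).prod * P a := by
  obtain ⟨n, rfl⟩ := Nat.exists_eq_succ_of_ne_zero hd.ne'
  rw [List.ofFn_succ', List.ofFn_succ, List.concat_eq_append, List.prod_append, List.prod_cons,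
    ← mul_assoc]
  simp [Fin.succ]

theorem vecMul_indicator {S R : Type*} [Fintype S] [DecidableEq S] [NonAssocSemiring R]
    (M : Matrix S S R) (s j : S) :
    Matrix.vecMul (fun σ => if σ = s then (1 : R) else 0) M j = M s j := by
  simp [Matrix.vecMul, dotProduct]

theorem belief_pushforward_consistency
    {S A : Type*} [Fintype S] [DecidableEq S] [Nonempty S] [Fintype A] [Nonempty A]
    (d : ℕ) (hd : 0 < d)
    (P : A → Matrix S S ℝ)
    (hP0 : ∀ a i j, 0 ≤ P a i j) (hP1 : ∀ a i, ∑ j, P a i j = 1)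
    (φ : S × (Fin d → A) → S → ℝ)
    (hφ : ∀ st : S × (Fin d → A),
      φ st = Matrix.vecMul (fun σ => if σ = st.1 then (1 : ℝ) else 0)
        ((List.ofFn fun k => P (st.2 k)).prod))
    (s : S) (as : Fin d → A) (a : A) (s'' : S) :
    ∑ s' : S, P (as ⟨0, hd⟩) s s' *
        φ (s', fun i : Fin d => if h : (i : ℕ) + 1 < d then as ⟨(i : ℕ) + 1, h⟩ else a) s''
      = ∑ σ : S, φ (s, as) σ * P a σ s'' := by
  simp only [hφ, vecMul_indicator]
  rw [← Matrix.mul_apply, ← Matrix.mul_apply, mul_prod_ofFn_shift P hd as a]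
end

section
/- In the delayed-MDP setup below, with rewards r : S → A → ℝ satisfying 0 ≤ r(s,a) ≤ R_max, discount γ ∈ [0,1), and Q* : S → A → ℝ satisfying the Bellman optimality equation Q*(s,a) = r(s,a) + γ · Σ_{s'} P_a(s,s') · max_{a'} Q*(s',a') with V*(s) = max_{a} Q*(s,a), let π̃ : S̃ → A be the EMQL policy: π̃(s̃) is a maximizer over a ∈ A of Σ_{s ∈ S} φ(s̃)(s) · Q*(s,a). Let P̃ : Matrix S̃ S̃ ℝ be the augmented transition matrix induced by π̃, let r̃(s̃) = Σ_{s ∈ S} φ(s̃)(s) · r(s, π̃(s̃)), and let Ṽ(s̃) = Σ_{k=0}^∞ γ^k (P̃^k.mulVec r̃)(s̃). Then for every augmented state s̃ ∈ S̃: Ṽ(s̃) ≥ Σ_{s ∈ S} φ(s̃)(s) · V*(s) − (R_max / (1 − γ)²) · (1 − 1/|A|). -/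
section StochasticMatrix

variable {ι : Type*} [Fintype ι] [DecidableEq ι] {M : Matrix ι ι ℝ}

theorem Matrix.mulVec_mono_of_rowStochastic (hM : M ∈ Matrix.rowStochastic ℝ ι) {f g : ι → ℝ}
    (hfg : ∀ i, f i ≤ g i) (i : ι) : M.mulVec f i ≤ M.mulVec g i :=
  Finset.sum_le_sum fun j _ => mul_le_mul_of_nonneg_left (hfg j) (hM.1 i j)

theorem Matrix.mulVec_const_of_rowStochastic (hM : M ∈ Matrix.rowStochastic ℝ ι) (c : ℝ) (i : ι) :
    M.mulVec (fun _ => c) i = c := by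
  simp [Matrix.mulVec, dotProduct, ← Finset.sum_mul, Matrix.sum_row_of_mem_rowStochastic hM]

theorem Matrix.mulVec_mem_Icc_of_rowStochastic (hM : M ∈ Matrix.rowStochastic ℝ ι) {f : ι → ℝ}
    {a b : ℝ} (hf : ∀ i, f i ∈ Set.Icc a b) (i : ι) : M.mulVec f i ∈ Set.Icc a b := by
  constructor
  · rw [← Matrix.mulVec_const_of_rowStochastic hM a i]
    exact Matrix.mulVec_mono_of_rowStochastic hM (fun j => (hf j).1) i
  · rw [← Matrix.mulVec_const_of_rowStochastic hM b i]
    exact Matrix.mulVec_mono_of_rowStochastic hM (fun j => (hf j).2) i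

/-- If `G` is an approximate subsolution, up to `c`, of the Bellman equation of a discounted Markov
reward process with bounded nonnegative rewards, then the value of the process is at least
`G - c / (1 - γ)`. -/
theorem Matrix.le_tsum_discounted_of_le_bellman (hM : M ∈ Matrix.rowStochastic ℝ ι)
    {γ : ℝ} (hγ0 : 0 ≤ γ) (hγ1 : γ < 1) {R : ℝ} {ρ : ι → ℝ} (hρ : ∀ i, ρ i ∈ Set.Icc 0 R)
    {c B : ℝ} {G : ι → ℝ} (hGB : ∀ i, G i ≤ B)
    (hc : 0 ≤ c) (hG : ∀ i, G i - c ≤ ρ i + γ * M.mulVec G i) (i : ι) :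
    G i - c / (1 - γ) ≤ ∑' k : ℕ, γ ^ k * (M ^ k).mulVec ρ i := by
  have h1γ : 0 < 1 - γ := sub_pos.2 hγ1
  have hbd : ∀ k i, (M ^ k).mulVec ρ i ∈ Set.Icc 0 R := fun k i =>
    Matrix.mulVec_mem_Icc_of_rowStochastic (pow_mem hM k) hρ i
  have hsum : Summable fun k : ℕ => γ ^ k * (M ^ k).mulVec ρ i :=
    Summable.of_nonneg_of_le (fun k => mul_nonneg (pow_nonneg hγ0 k) (hbd k i).1)
      (fun k => mul_le_mul_of_nonneg_left (hbd k i).2 (pow_nonneg hγ0 k))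
      ((summable_geometric_of_lt_one hγ0 hγ1).mul_right R)
  have hpartial : ∀ n i, G i - c / (1 - γ) - γ ^ n * B ≤
      ∑ k ∈ Finset.range n, γ ^ k * (M ^ k).mulVec ρ i := by
    intro n
    induction n with
    | zero =>
      intro i
      have := div_nonneg hc h1γ.le
      have := hGB i
      simp only [pow_zero, one_mul, Finset.range_zero, Finset.sum_empty]
      linarith
    | succ n ih =>
      intro i
      have hrec : ∑ k ∈ Finset.range (n + 1), γ ^ k * (M ^ k).mulVec ρ i =
          ρ i + γ * M.mulVec (fun j => ∑ k ∈ Finset.range n, γ ^ k * (M ^ k).mulVec ρ j) i := by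
        have hfun : (fun j => ∑ k ∈ Finset.range n, γ ^ k * (M ^ k).mulVec ρ j) =
            ∑ k ∈ Finset.range n, γ ^ k • (M ^ k).mulVec ρ := by
          ext j
          simp
        rw [Finset.sum_range_succ', hfun, Matrix.mulVec_sum, Finset.sum_apply, Finset.mul_sum,
          add_comm]
        simp [Matrix.mulVec_smul, Matrix.mulVec_mulVec, pow_succ', mul_assoc]
      rw [hrec]
      have hmono := Matrix.mulVec_mono_of_rowStochastic hM ih i
      have hsplit : M.mulVec (fun j => G j - c / (1 - γ) - γ ^ n * B) i =
          M.mulVec G i - c / (1 - γ) - γ ^ n * B := by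
        have : (fun j => G j - c / (1 - γ) - γ ^ n * B) =
            G - (fun _ => c / (1 - γ)) - fun _ => γ ^ n * B := rfl
        rw [this, Matrix.mulVec_sub, Matrix.mulVec_sub, Pi.sub_apply, Pi.sub_apply,
          Matrix.mulVec_const_of_rowStochastic hM, Matrix.mulVec_const_of_rowStochastic hM]
      rw [hsplit] at hmono
      have hc' : c / (1 - γ) = c + γ * (c / (1 - γ)) := by field_simp; ring
      have := mul_le_mul_of_nonneg_left hmono hγ0
      have := hG i
      rw [pow_succ]
      linarith
  have hlim : Filter.Tendsto (fun n : ℕ => G i - c / (1 - γ) - γ ^ n * B) Filter.atTop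
      (nhds (G i - c / (1 - γ))) := by
    simpa using tendsto_const_nhds.sub
      ((tendsto_pow_atTop_nhds_zero_of_lt_one hγ0 hγ1).mul_const B)
  exact le_of_tendsto_of_tendsto' hlim hsum.hasSum.tendsto_sum_nat fun n => hpartial n i

end StochasticMatrix

theorem Finset.univ_sup'_le_sum_of_nonneg {A : Type*} [Fintype A] [Nonempty A] {q : A → ℝ}
    (hq : ∀ a, 0 ≤ q a) :
    Finset.univ.sup' Finset.univ_nonempty q ≤ ∑ a, q a :=
  Finset.sup'_le _ _ fun a _ => Finset.single_le_sum (fun b _ => hq b) (Finset.mem_univ a)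

/-- Solutions of the Bellman optimality equation with rewards in `[0, R]` lie in
`[0, R / (1 - γ)]`. -/
theorem bellman_optimal_mem_Icc {S A : Type*} [Fintype S] [DecidableEq S] [Nonempty S]
    [Fintype A] [Nonempty A] {P : A → Matrix S S ℝ} (hP : ∀ a, P a ∈ Matrix.rowStochastic ℝ S)
    {r Q : S → A → ℝ} {R γ : ℝ} (hr : ∀ s a, 0 ≤ r s a ∧ r s a ≤ R) (hγ0 : 0 ≤ γ) (hγ1 : γ < 1)
    {V : S → ℝ} (hV : ∀ s, V s = Finset.univ.sup' Finset.univ_nonempty fun a => Q s a)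
    (hQ : ∀ s a, Q s a = r s a + γ * (P a).mulVec V s) (s : S) (a : A) :
    Q s a ∈ Set.Icc 0 (R / (1 - γ)) := by
  have h1γ : 0 < 1 - γ := sub_pos.2 hγ1
  obtain ⟨smin, hmin⟩ := Finite.exists_min V
  obtain ⟨smax, hmax⟩ := Finite.exists_max V
  have hbd : ∀ s a, (P a).mulVec V s ∈ Set.Icc (V smin) (V smax) := fun s a =>
    Matrix.mulVec_mem_Icc_of_rowStochastic (hP a) (fun j => ⟨hmin j, hmax j⟩) s
  have hlo : γ * V smin ≤ V smin := by
    obtain ⟨b⟩ : Nonempty A := inferInstance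
    calc γ * V smin ≤ Q smin b := by
          rw [hQ]
          linarith [(hr smin b).1, mul_le_mul_of_nonneg_left (hbd smin b).1 hγ0]
      _ ≤ V smin := by
          rw [hV]
          exact Finset.le_sup' (fun a => Q smin a) (Finset.mem_univ b)
  have hhi : V smax ≤ R + γ * V smax := by
    rw [hV smax]
    refine Finset.sup'_le _ _ fun b _ => ?_
    rw [← hV smax, hQ]
    linarith [(hr smax b).2, mul_le_mul_of_nonneg_left (hbd smax b).2 hγ0]
  have hminnn : 0 ≤ V smin := by nlinarith
  have hmaxle : V smax ≤ R / (1 - γ) := by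
    rw [le_div_iff₀ h1γ]
    linarith
  have hR : R / (1 - γ) = R + γ * (R / (1 - γ)) := by field_simp; ring
  rw [hQ]
  constructor
  · exact add_nonneg (hr s a).1 (mul_nonneg hγ0 (hminnn.trans (hbd s a).1))
  · rw [hR]
    exact add_le_add (hr s a).2 (mul_le_mul_of_nonneg_left ((hbd s a).2.trans hmaxle) hγ0)

theorem List.prod_ofFn_mul_eq_mul_prod_ofFn_shift {α M : Type*} [Monoid M] {d : ℕ} (hd : 0 < d)
    (P : α → M) (u : Fin d → α) (b : α) :
    (List.ofFn fun k => P (u k)).prod * P b =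
      P (u ⟨0, hd⟩) * (List.ofFn fun k : Fin d =>
        P (if h : (k : ℕ) + 1 < d then u ⟨(k : ℕ) + 1, h⟩ else b)).prod := by
  obtain ⟨n, rfl⟩ : ∃ n, d = n + 1 := ⟨d - 1, by omega⟩
  rw [List.ofFn_succ, List.ofFn_succ', List.prod_cons, List.concat_eq_append, List.prod_append]
  simp [mul_assoc, Fin.succ]


theorem emql_value_lower_bound
    {S A : Type*} [Fintype S] [DecidableEq S] [Nonempty S]
    [Fintype A] [DecidableEq A] [Nonempty A]
    (d : ℕ) (hd : 0 < d)
    (P : A → Matrix S S ℝ)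
    (hP0 : ∀ a i j, 0 ≤ P a i j) (hP1 : ∀ a i, ∑ j, P a i j = 1)
    (r : S → A → ℝ) (Rmax : ℝ) (hRmax : 0 ≤ Rmax)
    (hr : ∀ s a, 0 ≤ r s a ∧ r s a ≤ Rmax)
    (γ : ℝ) (hγ0 : 0 ≤ γ) (hγ1 : γ < 1)
    (Qstar : S → A → ℝ)
    (hQ : ∀ s a, Qstar s a = r s a + γ * ∑ s', P a s s' *
      (Finset.univ.sup' Finset.univ_nonempty fun a' => Qstar s' a'))
    (Vstar : S → ℝ)
    (hV : ∀ s, Vstar s = Finset.univ.sup' Finset.univ_nonempty fun a => Qstar s a)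
    (φ : S × (Fin d → A) → S → ℝ)
    (hφ : ∀ st : S × (Fin d → A),
      φ st = Matrix.vecMul (fun σ => if σ = st.1 then (1 : ℝ) else 0)
        ((List.ofFn fun k => P (st.2 k)).prod))
    (πt : S × (Fin d → A) → A)
    (hπ : ∀ (st : S × (Fin d → A)) (a : A),
      ∑ s, φ st s * Qstar s a ≤ ∑ s, φ st s * Qstar s (πt st))
    (Pt : Matrix (S × (Fin d → A)) (S × (Fin d → A)) ℝ)
    (hPt : ∀ st tt : S × (Fin d → A),
      Pt st tt =
        if tt.2 = (fun i : Fin d =>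
            if h : (i : ℕ) + 1 < d then st.2 ⟨(i : ℕ) + 1, h⟩ else πt st)
        then P (st.2 ⟨0, hd⟩) st.1 tt.1 else 0)
    (rt : S × (Fin d → A) → ℝ)
    (hrt : ∀ st : S × (Fin d → A), rt st = ∑ s, φ st s * r s (πt st))
    (Vt : S × (Fin d → A) → ℝ)
    (hVt : ∀ st : S × (Fin d → A), Vt st = ∑' k : ℕ, γ ^ k * ((Pt ^ k).mulVec rt) st) :
    ∀ st : S × (Fin d → A),
      Vt st ≥ ∑ s, φ st s * Vstar s
        - (Rmax / (1 - γ) ^ 2) * (1 - 1 / (Fintype.card A : ℝ)) := by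
  have hP : ∀ a, P a ∈ Matrix.rowStochastic ℝ S := fun a =>
    Matrix.mem_rowStochastic_iff_sum.2 ⟨hP0 a, hP1 a⟩
  have h1γ : 0 < 1 - γ := sub_pos.2 hγ1
  set N : S × (Fin d → A) → Matrix S S ℝ := fun st => (List.ofFn fun k => P (st.2 k)).prod with hN
  have hNmem : ∀ st, N st ∈ Matrix.rowStochastic ℝ S := fun st =>
    list_prod_mem fun M hM => by
      obtain ⟨k, rfl⟩ := List.mem_ofFn.1 hM
      exact hP _
  have hφN : ∀ st f, ∑ s, φ st s * f s = (N st).mulVec f st.1 := fun st f => by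
    rw [hφ]
    simp [Matrix.vecMul, Matrix.mulVec, dotProduct, hN]
  simp only [← hV] at hQ
  have hQmem := bellman_optimal_mem_Icc hP hr hγ0 hγ1 hV hQ
  set B := Rmax / (1 - γ) with hB
  have hB0 : 0 ≤ B := div_nonneg hRmax h1γ.le
  have hVmem : ∀ s, Vstar s ∈ Set.Icc 0 B := fun s => by
    rw [hV]
    obtain ⟨a, -, ha⟩ := Finset.exists_mem_eq_sup' Finset.univ_nonempty fun a => Qstar s a
    rw [ha]
    exact hQmem s a
  set G : S × (Fin d → A) → ℝ := fun st => ∑ s, φ st s * Vstar s with hG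
  have hGB : ∀ st, G st ∈ Set.Icc 0 B := fun st => by
    simp only [hG, hφN]
    exact Matrix.mulVec_mem_Icc_of_rowStochastic (hNmem st) hVmem st.1
  set shift : S × (Fin d → A) → Fin d → A := fun st i =>
    if h : (i : ℕ) + 1 < d then st.2 ⟨(i : ℕ) + 1, h⟩ else πt st with hshift
  have hPtsum : ∀ st f, Pt.mulVec f st =
      (P (st.2 ⟨0, hd⟩)).mulVec (fun s' => f (s', shift st)) st.1 := fun st f => by
    simp only [Matrix.mulVec, dotProduct, hPt, Fintype.sum_prod_type, ite_mul, zero_mul]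
    simp [hshift]
  have hPtmem : Pt ∈ Matrix.rowStochastic ℝ (S × (Fin d → A)) := by
    refine ⟨fun st tt => ?_, ?_⟩
    · rw [hPt]
      split_ifs
      exacts [hP0 _ _ _, le_rfl]
    · ext st
      rw [hPtsum]
      exact Matrix.mulVec_const_of_rowStochastic (hP _) 1 st.1
  have hrtmem : ∀ st, rt st ∈ Set.Icc 0 Rmax := fun st => by
    rw [hrt, hφN st fun s => r s (πt st)]
    exact Matrix.mulVec_mem_Icc_of_rowStochastic (hNmem st) (fun s => hr s _) st.1
  have hbelief : ∀ st, Pt.mulVec G st = (N st).mulVec ((P (πt st)).mulVec Vstar) st.1 :=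
    fun st => by
      rw [Matrix.mulVec_mulVec, hN]
      simp only
      rw [List.prod_ofFn_mul_eq_mul_prod_ofFn_shift hd, ← Matrix.mulVec_mulVec, hPtsum]
      simp only [hG, hφN]
      rfl
  have hbellman : ∀ st, ∑ s, φ st s * Qstar s (πt st) = rt st + γ * Pt.mulVec G st := fun st => by
    rw [hbelief, hrt, ← hφN, Finset.mul_sum, ← Finset.sum_add_distrib]
    refine Finset.sum_congr rfl fun s _ => ?_
    rw [hQ]
    simp only [Matrix.mulVec, dotProduct]
    ring
  have hcard : (0 : ℝ) < Fintype.card A := by exact_mod_cast Fintype.card_pos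
  have hgreedy : ∀ st, G st / Fintype.card A ≤ ∑ s, φ st s * Qstar s (πt st) := fun st => by
    rw [div_le_iff₀' hcard]
    calc G st ≤ ∑ s, φ st s * ∑ a, Qstar s a := by
          simp only [hG, hφN]
          refine Matrix.mulVec_mono_of_rowStochastic (hNmem st) (fun s => ?_) st.1
          rw [hV]
          exact Finset.univ_sup'_le_sum_of_nonneg fun a => (hQmem s a).1
      _ = ∑ a, ∑ s, φ st s * Qstar s a := by
          simp only [Finset.mul_sum]
          exact Finset.sum_comm
      _ ≤ ∑ _a : A, ∑ s, φ st s * Qstar s (πt st) := Finset.sum_le_sum fun a _ => hπ st a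
      _ = _ := by simp
  have hfrac : (0 : ℝ) ≤ 1 - 1 / Fintype.card A := by
    rw [sub_nonneg, div_le_one hcard]
    exact_mod_cast Fintype.card_pos (α := A)
  intro st
  have hmain := Matrix.le_tsum_discounted_of_le_bellman hPtmem hγ0 hγ1 hrtmem
    (c := B * (1 - 1 / Fintype.card A)) (fun st => (hGB st).2) (mul_nonneg hB0 hfrac)
    (fun st => by
      rw [← hbellman]
      refine le_trans ?_ (hgreedy st)
      have := mul_le_mul_of_nonneg_right (hGB st).2 hfrac
      rw [mul_sub, mul_one_div] at this
      linarith) st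
  rw [hVt, ge_iff_le]
  convert hmain using 2
  rw [hB]
  field_simp
end
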